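/- Let λ ∈ k^c be nonzero and let M be a finitely generated left A-module. Then the following are equivalent: (i) M is not projective as a module over the subalgebra k[u_λ] of A generated by u_λ; (ii) there exists an A-module homomorphism Au_λ → M that does not factor through any projective A-module; (iii) there exists an A-module homomorphism Au_λ^{a−1} → M that does not factor through any projective A-module. -/

import Mathlib

open scoped TensorProduct

/-- The relations defining the quantum complete intersection `A^c_q`:
`x_i ^ a = 0` for all `i`, and `x_i x_j = q • x_j x_i` for `i < j`. -/
inductive QCIRel (k : Type) [Field k] (c a : ℕ) (q : k) :
    FreeAlgebra k (Fin c) → FreeAlgebra k (Fin c) → Prop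
  | pow (i : Fin c) : QCIRel k c a q (FreeAlgebra.ι k i ^ a) 0
  | comm (i j : Fin c) (hij : i < j) :
      QCIRel k c a q (FreeAlgebra.ι k i * FreeAlgebra.ι k j)
        (q • (FreeAlgebra.ι k j * FreeAlgebra.ι k i))

/-- The quantum complete intersection algebra `A^c_q = k⟨x_1,…,x_c⟩/(x_i^a, x_ix_j - q x_jx_i)`. -/
def QCI (k : Type) [Field k] (c a : ℕ) (q : k) : Type := RingQuot (QCIRel k c a q)

noncomputable instance (k : Type) [Field k] (c a : ℕ) (q : k) : Ring (QCI k c a q) :=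
  inferInstanceAs (Ring (RingQuot (QCIRel k c a q)))

noncomputable instance (k : Type) [Field k] (c a : ℕ) (q : k) : Algebra k (QCI k c a q) :=
  inferInstanceAs (Algebra k (RingQuot (QCIRel k c a q)))

namespace QCI

variable (k : Type) [Field k] (c a : ℕ) (q : k)

/-- The generators `x_i` of the quantum complete intersection. -/
noncomputable def x (i : Fin c) : QCI k c a q :=
  RingQuot.mkAlgHom k (QCIRel k c a q) (FreeAlgebra.ι k i)

/-- The element `u_λ = λ_1 x_1 + ⋯ + λ_c x_c` of `A^c_q`. -/
noncomputable def u (lam : Fin c → k) : QCI k c a q :=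
  ∑ i, lam i • QCI.x k c a q i

end QCI

/-- `a' = a / gcd(a, char k)` if `char k > 0`, and `a' = a` if `char k = 0`. -/
noncomputable def aprime (k : Type) [Field k] (a : ℕ) : ℕ :=
  if ringChar k > 0 then a / Nat.gcd a (ringChar k) else a

set_option synthInstance.maxHeartbeats 400000

section GaussianBinomial

variable {k : Type*} [Field k]

/-- The Gaussian binomial coefficient `[n choose j]_q`, defined by the `q`-Pascal rule. -/
def gaussBinom (q : k) : ℕ → ℕ → k
  | _, 0 => 1
  | 0, _ + 1 => 0
  | n + 1, j + 1 => gaussBinom q n j + q ^ (j + 1) * gaussBinom q n (j + 1)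

theorem gaussBinom_zero_right (q : k) (n : ℕ) : gaussBinom q n 0 = 1 := by
  cases n <;> rfl

theorem gaussBinom_succ_succ (q : k) (n j : ℕ) :
    gaussBinom q (n + 1) (j + 1) =
      gaussBinom q n j + q ^ (j + 1) * gaussBinom q n (j + 1) := rfl

theorem gaussBinom_eq_zero_of_lt (q : k) {n j : ℕ} (h : n < j) : gaussBinom q n j = 0 := by
  induction n generalizing j with
  | zero => obtain ⟨j, rfl⟩ := Nat.exists_eq_succ_of_ne_zero h.ne'; rfl
  | succ n ih =>
    obtain ⟨j, rfl⟩ := Nat.exists_eq_succ_of_ne_zero (Nat.ne_zero_of_lt h)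
    rw [gaussBinom_succ_succ, ih (by omega), ih (by omega)]
    simp

theorem gaussBinom_self (q : k) (n : ℕ) : gaussBinom q n n = 1 := by
  induction n with
  | zero => rfl
  | succ n ih => rw [gaussBinom_succ_succ, ih, gaussBinom_eq_zero_of_lt q n.lt_succ_self]; simp

theorem gaussBinom_absorption (q : k) (n j : ℕ) :
    (q ^ (j + 1) - 1) * gaussBinom q (n + 1) (j + 1) = (q ^ (n + 1) - 1) * gaussBinom q n j := by
  induction n generalizing j with
  | zero =>
    cases j with
    | zero => simp [gaussBinom]
    | succ j => simp [gaussBinom]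
  | succ n ih =>
    rw [gaussBinom_succ_succ]
    cases j with
    | zero =>
      have h := ih 0
      simp only [gaussBinom_zero_right] at h ⊢
      linear_combination q ^ (0 + 1) * h
    | succ j =>
      have h := ih (j + 1)
      have h' := ih j
      have h'' := gaussBinom_succ_succ q n j
      linear_combination q ^ (j + 1 + 1) * h + q * h' - q * (q ^ (n + 1) - 1) * h''

theorem gaussBinom_eq_zero_of_isPrimitiveRoot {q : k} {m j : ℕ} (hq : IsPrimitiveRoot q m)
    (hj : j ≠ 0) (hjm : j < m) : gaussBinom q m j = 0 := by
  obtain ⟨j, rfl⟩ := Nat.exists_eq_succ_of_ne_zero hj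
  obtain ⟨m, rfl⟩ := Nat.exists_eq_succ_of_ne_zero (Nat.ne_zero_of_lt hjm)
  have h := gaussBinom_absorption q m j
  rw [hq.pow_eq_one, sub_self, zero_mul] at h
  exact (mul_eq_zero.1 h).resolve_left (sub_ne_zero.2 (hq.pow_ne_one_of_pos_of_lt hj hjm))

variable {B : Type*} [Ring B] [Algebra k B] {q : k} {v y : B}

theorem mul_pow_of_qCommute (h : v * y = q • (y * v)) (n : ℕ) :
    v * y ^ n = q ^ n • (y ^ n * v) := by
  induction n with
  | zero => simp
  | succ n ih =>
    rw [pow_succ, ← mul_assoc, ih, smul_mul_assoc, mul_assoc, h, mul_smul_comm, smul_smul,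
      ← mul_assoc, pow_succ]

/-- The `q`-binomial theorem. -/
theorem add_pow_of_qCommute (h : v * y = q • (y * v)) (n : ℕ) :
    (v + y) ^ n = ∑ j ∈ Finset.range (n + 1), gaussBinom q n j • (y ^ j * v ^ (n - j)) := by
  induction n with
  | zero => simp [gaussBinom]
  | succ n ih =>
    have hv : v * (v + y) ^ n = ∑ j ∈ Finset.range (n + 2),
        (q ^ j * gaussBinom q n j) • (y ^ j * v ^ (n + 1 - j)) := by
      rw [Finset.sum_range_succ, gaussBinom_eq_zero_of_lt q n.lt_succ_self, mul_zero, zero_smul,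
        add_zero, ih, Finset.mul_sum]
      refine Finset.sum_congr rfl fun j hj => ?_
      have hj : j ≤ n := Nat.lt_succ_iff.1 (Finset.mem_range.1 hj)
      rw [mul_smul_comm, ← mul_assoc, mul_pow_of_qCommute h, smul_mul_assoc, smul_smul, mul_assoc,
        ← pow_succ', Nat.sub_add_comm hj, mul_comm]
    have hy : y * (v + y) ^ n = ∑ j ∈ Finset.range (n + 1),
        gaussBinom q n j • (y ^ (j + 1) * v ^ (n + 1 - (j + 1))) := by
      rw [ih, Finset.mul_sum]
      refine Finset.sum_congr rfl fun j _ => ?_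
      rw [mul_smul_comm, ← mul_assoc, ← pow_succ', Nat.add_sub_add_right]
    rw [pow_succ', add_mul, hv, hy, Finset.sum_range_succ', Finset.sum_range_succ' _ (n + 1),
      add_right_comm, ← Finset.sum_add_distrib]
    simp only [gaussBinom_succ_succ, gaussBinom_zero_right, ← add_smul, pow_zero, one_mul]
    simp only [add_comm]

theorem add_pow_of_isPrimitiveRoot {m : ℕ} (hq : IsPrimitiveRoot q m) (hm : m ≠ 0)
    (h : v * y = q • (y * v)) : (v + y) ^ m = v ^ m + y ^ m := by
  obtain ⟨m, rfl⟩ := Nat.exists_eq_succ_of_ne_zero hm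
  rw [add_pow_of_qCommute h, Finset.sum_range_succ, Finset.sum_range_succ', Finset.sum_eq_zero]
  · simp [gaussBinom_self, gaussBinom_zero_right]
  · intro j hj
    rw [gaussBinom_eq_zero_of_isPrimitiveRoot hq j.succ_ne_zero
      (by have := Finset.mem_range.1 hj; omega), zero_smul]

theorem commute_pow_of_qCommute {m : ℕ} (hq : q ^ m = 1) (h : v * y = q • (y * v)) :
    Commute (v ^ m) (y ^ m) := by
  have h1 : Commute v (y ^ m) := by
    rw [Commute, SemiconjBy, mul_pow_of_qCommute h, hq, one_smul]
  exact h1.pow_left m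

theorem aprime_eq_or {k : Type} [Field k] (a : ℕ) :
    aprime k a = a ∨ ∃ p, p.Prime ∧ CharP k p ∧ a = aprime k a * p := by
  unfold aprime
  split_ifs with hp
  · have hprime : (ringChar k).Prime :=
      (CharP.char_is_prime_or_zero k (ringChar k)).resolve_right hp.ne'
    rcases (Nat.dvd_prime hprime).1 (Nat.gcd_dvd_right a (ringChar k)) with h | h
    · exact Or.inl (by rw [h, Nat.div_one])
    · refine Or.inr ⟨ringChar k, hprime, inferInstance, ?_⟩
      rw [h, Nat.div_mul_cancel (h ▸ Nat.gcd_dvd_left _ _)]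
  · exact Or.inl rfl

theorem aprime_ne_zero {k : Type} [Field k] {a : ℕ} (ha : a ≠ 0) : aprime k a ≠ 0 := by
  rcases aprime_eq_or (k := k) a with h | ⟨p, -, -, h⟩
  · rwa [h]
  · intro h0
    rw [h0, zero_mul] at h
    exact ha h

theorem add_pow_eq_zero_of_qCommute {k : Type} [Field k] {B : Type*} [Ring B] [Algebra k B] {q : k}
    {v y : B} {a : ℕ} (ha : a ≠ 0) (hq : IsPrimitiveRoot q (aprime k a))
    (h : v * y = q • (y * v)) (hv : v ^ a = 0) (hy : y ^ a = 0) : (v + y) ^ a = 0 := by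
  have hadd := add_pow_of_isPrimitiveRoot hq (aprime_ne_zero ha) h
  rcases aprime_eq_or (k := k) a with h' | ⟨p, hp, hchar, h'⟩
  · rw [h'] at hadd
    rw [hadd, hv, hy, add_zero]
  · have := Fact.mk hp
    cases subsingleton_or_nontrivial B
    · exact Subsingleton.elim _ _
    have : CharP B p := charP_of_injective_algebraMap (algebraMap k B).injective p
    rw [h', pow_mul, hadd, add_pow_char_of_commute _ (commute_pow_of_qCommute hq.pow_eq_one h),
      ← pow_mul, ← pow_mul, ← h', hv, hy, add_zero]

end GaussianBinomial

section Projective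

variable {R : Type*} [Ring R] {M : Type*} [AddCommGroup M] [Module R M]

theorem exists_smul_eq_of_projective [Module.Projective R M] {s t : R}
    (hR : ∀ b : R, t * b = 0 → ∃ d, b = s * d) (m : M) (hm : t • m = 0) : ∃ n : M, m = s • n := by
  obtain ⟨σ, hσ⟩ := Module.projective_def.1 (inferInstance : Module.Projective R M)
  have hx : ∀ x, ∃ d, σ m x = s * d := fun x => hR _ <| by
    have : t • σ m = 0 := by rw [← map_smul, hm, map_zero]
    simpa using DFunLike.congr_fun this x
  choose d hd using hx
  refine ⟨∑ x ∈ (σ m).support, d x • x, ?_⟩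
  conv_lhs => rw [← hσ m, Finsupp.linearCombination_apply, Finsupp.sum]
  rw [Finset.smul_sum]
  exact Finset.sum_congr rfl fun x _ => by rw [hd x, mul_smul, id]

theorem ker_pow_pred_of_ker {t : R} {a : ℕ}
    (h : ∀ m : M, t • m = 0 → ∃ n : M, m = t ^ (a - 1) • n) (m : M) (hm : t ^ (a - 1) • m = 0) :
    ∃ n : M, m = t • n := by
  suffices H : ∀ j ≤ a - 1, ∀ m : M, t ^ j • m = 0 → ∃ n : M, m = t • n from H _ le_rfl m hm
  intro j
  induction j with
  | zero => intro _ m hm; exact ⟨0, by simpa using hm⟩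
  | succ j ih =>
    intro hj m hm
    obtain ⟨n, hn⟩ := h (t ^ j • m) (by rwa [smul_smul, ← pow_succ'])
    obtain ⟨e, he⟩ : ∃ e, a - 1 = j + (e + 1) := ⟨a - 1 - j - 1, by omega⟩
    obtain ⟨n', hn'⟩ := ih (by omega) (m - t ^ (e + 1) • n) (by
      rw [smul_sub, hn, smul_smul, ← pow_add, he, sub_self])
    refine ⟨n' + t ^ e • n, ?_⟩
    rw [smul_add, ← hn', smul_smul, ← pow_succ', sub_add_cancel]

theorem ker_of_ker_pow_pred {t : R} {a : ℕ} (ha : 2 ≤ a)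
    (h : ∀ m : M, t ^ (a - 1) • m = 0 → ∃ n : M, m = t • n) (m : M) (hm : t • m = 0) :
    ∃ n : M, m = t ^ (a - 1) • n := by
  suffices H : ∀ j ≤ a - 1, ∃ n : M, m = t ^ j • n from H _ le_rfl
  intro j
  induction j with
  | zero => intro _; exact ⟨m, by simp⟩
  | succ j ih =>
    intro hj
    obtain ⟨n, hn⟩ := ih (by omega)
    obtain ⟨n', hn'⟩ := h n (by
      obtain ⟨e, he⟩ : ∃ e, a - 1 = e + (j + 1) := ⟨a - 1 - (j + 1), by omega⟩
      rw [he, pow_add, pow_succ', mul_smul, mul_smul, ← hn, hm, smul_zero])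
    exact ⟨n', by rw [hn, hn', smul_smul, pow_succ]⟩

/-- If every element of `R` is a scalar plus a multiple of the nilpotent `t`, then a module on which
`t` acts exactly is free. -/
theorem free_of_ker_pow_pred {k : Type*} [Field k] [Algebra k R] [Module k M] [IsScalarTower k R M]
    {t : R} {a : ℕ} (ht : t ^ a = 0)
    (hR : ∀ r : R, ∃ (c : k) (s : R), r = algebraMap k R c + t * s)
    (h : ∀ m : M, t ^ (a - 1) • m = 0 → ∃ n : M, m = t • n) : Module.Free R M := by
  let T : M →ₗ[k] M := Algebra.lsmul k k M t
  have hT : ∀ m, T m = t • m := fun _ => rfl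
  let bs := Module.Basis.ofVectorSpace k (M ⧸ LinearMap.range T)
  choose e he using fun i => Submodule.mkQ_surjective (LinearMap.range T) (bs i)
  have hli : LinearIndependent R e := by
    rw [linearIndependent_iff']
    intro S g hg
    have key : ∀ j ≤ a, ∀ i ∈ S, ∃ s, g i = t ^ j * s := by
      intro j
      induction j with
      | zero => intro _ i _; exact ⟨g i, by simp⟩
      | succ j ih =>
        intro hj
        have hex : ∀ i, ∃ (c : k) (s : R), i ∈ S → g i = t ^ j * (algebraMap k R c + t * s) := by
          intro i
          by_cases hi : i ∈ S
          · obtain ⟨r, hr⟩ := ih (by omega) i hi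
            obtain ⟨c, s, rfl⟩ := hR r
            exact ⟨c, s, fun _ => hr⟩
          · exact ⟨0, 0, fun hi' => absurd hi' hi⟩
        choose c s hcs using hex
        have h0 : t ^ (a - 1) • ∑ i ∈ S, c i • e i = 0 := by
          have h1 : t ^ (a - 1 - j) • ∑ i ∈ S, g i • e i = t ^ (a - 1) • ∑ i ∈ S, c i • e i := by
            rw [Finset.smul_sum, Finset.smul_sum]
            refine Finset.sum_congr rfl fun i hi => ?_
            rw [hcs i hi, smul_smul, ← mul_assoc, ← pow_add, Nat.sub_add_cancel (by omega),
              mul_add, ← mul_assoc, ← pow_succ, Nat.sub_add_cancel (by omega), ht, zero_mul,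
              add_zero, mul_smul, algebraMap_smul]
          rw [← h1, hg, smul_zero]
        obtain ⟨n, hn⟩ := h _ h0
        have h2 : ∑ i ∈ S, c i • bs i = 0 := by
          have : (LinearMap.range T).mkQ (∑ i ∈ S, c i • e i) = 0 := by
            rw [Submodule.mkQ_apply, Submodule.Quotient.mk_eq_zero, hn]
            exact ⟨n, rfl⟩
          simpa [map_sum, ← he] using this
        have h3 := linearIndependent_iff'.1 bs.linearIndependent S c h2
        intro i hi
        refine ⟨s i, ?_⟩
        rw [hcs i hi, h3 i hi, map_zero, zero_add, ← mul_assoc, pow_succ]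
    intro i hi
    obtain ⟨s, hs⟩ := key a le_rfl i hi
    rw [hs, ht, zero_mul]
  have hsp : ⊤ ≤ Submodule.span R (Set.range e) := by
    have h1 : ∀ m : M, ∃ x ∈ Submodule.span R (Set.range e), ∃ n, m = x + t • n := by
      intro m
      have hm : (LinearMap.range T).mkQ m ∈ Submodule.span k (Set.range bs) := by
        rw [bs.span_eq]; trivial
      have hr : Set.range bs = (LinearMap.range T).mkQ '' Set.range e := by
        rw [← Set.range_comp]; exact congrArg _ (funext fun i => (he i).symm)
      rw [hr, Submodule.span_image] at hm
      obtain ⟨x, hx, hxm⟩ := hm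
      refine ⟨x, Submodule.span_le_restrictScalars k R _ hx, ?_⟩
      have : m - x ∈ LinearMap.range T := by
        rw [← Submodule.Quotient.mk_eq_zero, Submodule.Quotient.mk_sub]
        exact sub_eq_zero.2 hxm.symm
      obtain ⟨n, hn⟩ := this
      exact ⟨n, by rw [← hT, hn, add_sub_cancel]⟩
    have h2 : ∀ j, ∀ m : M, ∃ x ∈ Submodule.span R (Set.range e), ∃ n, m = x + t ^ j • n := by
      intro j
      induction j with
      | zero => exact fun m => ⟨0, zero_mem _, m, by simp⟩
      | succ j ih =>
        intro m
        obtain ⟨x, hx, n, rfl⟩ := ih m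
        obtain ⟨x', hx', n', rfl⟩ := h1 n
        refine ⟨x + t ^ j • x', add_mem hx (Submodule.smul_mem _ _ hx'), n', ?_⟩
        rw [smul_add, smul_smul, ← pow_succ, add_assoc]
    intro m _
    obtain ⟨x, hx, n, rfl⟩ := h2 a m
    rwa [ht, zero_smul, add_zero]
  exact Module.Free.of_basis (Module.Basis.mk hli hsp)

/-- Homomorphisms `Rs → M` not factoring through a projective module correspond to elements of `M`
killed by `t` which are not multiples of `s`. -/
theorem exists_nonfactoring_iff {R : Type} [Ring R] {M : Type} [AddCommGroup M] [Module R M]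
    {s t : R} (hts : t * s = 0) (hl : ∀ b : R, t * b = 0 → ∃ d, b = s * d)
    (hr : ∀ b : R, b * s = 0 → ∃ d, b = d * t) :
    (∃ f : (Submodule.span R {s}) →ₗ[R] M,
        ∀ (P : Type) (_ : AddCommGroup P) (_ : Module R P),
          Module.Projective R P →
          ∀ (g : (Submodule.span R {s}) →ₗ[R] P) (h : P →ₗ[R] M), f ≠ h ∘ₗ g) ↔
      ∃ m : M, t • m = 0 ∧ ∀ n : M, m ≠ s • n := by
  let s' : Submodule.span R {s} := ⟨s, Submodule.mem_span_singleton_self s⟩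
  have hts' : t • s' = 0 := Subtype.ext hts
  constructor
  · rintro ⟨f, hf⟩
    refine ⟨f s', by rw [← map_smul, hts', map_zero], fun n hn => ?_⟩
    refine hf R _ _ inferInstance (Submodule.subtype _) (LinearMap.toSpanSingleton R M n) ?_
    ext ⟨x, hx⟩
    obtain ⟨r, rfl⟩ := Submodule.mem_span_singleton.1 hx
    change f (r • s') = (r • s) • n
    rw [map_smul, hn, smul_assoc]
  · rintro ⟨m, hm, hn⟩
    let φ : R →ₗ[R] Submodule.span R {s} := LinearMap.toSpanSingleton R _ s'
    have hφ : Function.Surjective φ := by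
      rintro ⟨x, hx⟩
      obtain ⟨r, rfl⟩ := Submodule.mem_span_singleton.1 hx
      exact ⟨r, rfl⟩
    have hker : LinearMap.ker φ ≤ LinearMap.ker (LinearMap.toSpanSingleton R M m) := by
      intro b hb
      obtain ⟨d, rfl⟩ := hr b (congrArg Subtype.val (LinearMap.mem_ker.1 hb))
      rw [LinearMap.mem_ker, LinearMap.toSpanSingleton_apply, mul_smul, hm, smul_zero]
    let f : Submodule.span R {s} →ₗ[R] M :=
      (LinearMap.ker φ).liftQ _ hker ∘ₗ (φ.quotKerEquivOfSurjective hφ).symm.toLinearMap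
    have hf : f s' = m := by
      have : (φ.quotKerEquivOfSurjective hφ).symm s' = Submodule.Quotient.mk 1 := by
        rw [LinearEquiv.symm_apply_eq]
        change s' = (1 : R) • s'
        rw [one_smul]
      change (LinearMap.ker φ).liftQ _ hker ((φ.quotKerEquivOfSurjective hφ).symm s') = m
      rw [this]
      change (1 : R) • m = m
      rw [one_smul]
    refine ⟨f, fun P _ _ _ g h hgh => ?_⟩
    obtain ⟨p, hp⟩ := exists_smul_eq_of_projective hl (g s') (by rw [← map_smul, hts', map_zero])
    refine hn (h p) ?_
    rw [← hf, hgh, LinearMap.comp_apply, hp, map_smul]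

end Projective

namespace QCI

variable {k : Type} [Field k] {c d a : ℕ} {q : k}

theorem x_pow (i : Fin c) : x k c a q i ^ a = 0 := by
  have h := RingQuot.mkAlgHom_rel k (QCIRel.pow (k := k) (a := a) (q := q) i)
  rw [map_pow, map_zero] at h
  exact h

theorem x_mul_x {i j : Fin c} (hij : i < j) :
    x k c a q i * x k c a q j = q • (x k c a q j * x k c a q i) := by
  have h := RingQuot.mkAlgHom_rel k (QCIRel.comm (k := k) (a := a) (q := q) i j hij)
  rw [map_mul, map_smul, map_mul] at h
  exact h

/-- The universal property of the quantum complete intersection. -/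
noncomputable def lift {B : Type*} [Ring B] [Algebra k B] (f : Fin c → B) (hpow : ∀ i, f i ^ a = 0)
    (hcomm : ∀ i j, i < j → f i * f j = q • (f j * f i)) : QCI k c a q →ₐ[k] B :=
  RingQuot.liftAlgHom k ⟨FreeAlgebra.lift k f, by
    rintro _ _ (i | ⟨i, j, hij⟩)
    · simp [hpow]
    · simp [hcomm i j hij]⟩

theorem lift_x {B : Type*} [Ring B] [Algebra k B] (f : Fin c → B) (hpow : ∀ i, f i ^ a = 0)
    (hcomm : ∀ i j, i < j → f i * f j = q • (f j * f i)) (i : Fin c) :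
    lift f hpow hcomm (x k c a q i) = f i := by
  refine (RingQuot.liftAlgHom_mkAlgHom_apply k _ _ _).trans ?_
  simp

theorem induction_on {P : QCI k c a q → Prop} (b : QCI k c a q)
    (algebraMap : ∀ r : k, P (algebraMap k _ r)) (x : ∀ i, P (x k c a q i))
    (add : ∀ b b', P b → P b' → P (b + b')) (mul : ∀ b b', P b → P b' → P (b * b')) : P b := by
  obtain ⟨b, rfl⟩ := RingQuot.mkAlgHom_surjective k (QCIRel k c a q) b
  induction b using FreeAlgebra.induction with
  | grade0 r => rw [AlgHom.commutes]; exact algebraMap r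
  | grade1 i => exact x i
  | mul b b' h h' => rw [map_mul]; exact mul _ _ h h'
  | add b b' h h' => rw [map_add]; exact add _ _ h h'

/-- The homomorphism induced by a strictly increasing map of variables. -/
noncomputable def incl (e : Fin c → Fin d) (he : StrictMono e) : QCI k c a q →ₐ[k] QCI k d a q :=
  lift (fun i => x k d a q (e i)) (fun _ => x_pow _) fun _ _ hij => x_mul_x (he hij)

theorem incl_x (e : Fin c → Fin d) (he : StrictMono e) (i : Fin c) :
    incl e he (x k c a q i) = x k d a q (e i) :=
  lift_x _ _ _ _

theorem incl_u (e : Fin c → Fin d) (he : StrictMono e) (lam : Fin c → k) :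
    incl e he (u k c a q lam) = ∑ i, lam i • x k d a q (e i) := by
  simp [u, incl_x]

theorem u_pow (ha : a ≠ 0) (hq : IsPrimitiveRoot q (aprime k a)) (lam : Fin c → k) :
    u k c a q lam ^ a = 0 := by
  induction c with
  | zero => simp [u, ha]
  | succ c ih =>
    have hu : u k (c + 1) a q lam = incl Fin.castSucc Fin.strictMono_castSucc
        (u k c a q fun i => lam i.castSucc) + lam (Fin.last c) • x k (c + 1) a q (Fin.last c) := by
      rw [incl_u, u, Fin.sum_univ_castSucc]
    rw [hu]
    refine add_pow_eq_zero_of_qCommute ha hq ?_ (by rw [← map_pow, ih, map_zero])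
      (by rw [smul_pow, x_pow, smul_zero])
    rw [incl_u, Finset.sum_mul, Finset.mul_sum, Finset.smul_sum]
    refine Finset.sum_congr rfl fun i _ => ?_
    rw [smul_mul_smul_comm, smul_mul_smul_comm, x_mul_x (Fin.castSucc_lt_last i), smul_smul,
      smul_smul]
    congr 1
    ring

/-- The map `(b_j)_j ↦ ∑ u_λ^j b_j`, where the `b_j` do not involve the `i`-th variable. -/
noncomputable def expand (lam : Fin (c + 1) → k) (i : Fin (c + 1)) :
    (Fin a → QCI k c a q) →ₗ[k] QCI k (c + 1) a q :=
  ∑ j : Fin a, LinearMap.mulLeft k (u k (c + 1) a q lam ^ (j : ℕ)) ∘ₗ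
    (incl i.succAbove (Fin.strictMono_succAbove i)).toLinearMap ∘ₗ LinearMap.proj j

theorem expand_apply (lam : Fin (c + 1) → k) (i : Fin (c + 1)) (f : Fin a → QCI k c a q) :
    expand lam i f = ∑ j : Fin a, u k (c + 1) a q lam ^ (j : ℕ) *
      incl i.succAbove (Fin.strictMono_succAbove i) (f j) := by
  simp [expand]

theorem expand_single (lam : Fin (c + 1) → k) (i : Fin (c + 1)) (j : Fin a) (b : QCI k c a q) :
    expand lam i (Pi.single j b) = u k (c + 1) a q lam ^ (j : ℕ) *
      incl i.succAbove (Fin.strictMono_succAbove i) b := by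
  rw [expand_apply, Finset.sum_eq_single j]
  · simp
  · intro j' _ hj'; simp [Pi.single_eq_of_ne hj']
  · simp

theorem u_eq_succAbove (lam : Fin (c + 1) → k) (i : Fin (c + 1)) :
    u k (c + 1) a q lam = lam i • x k (c + 1) a q i +
      incl i.succAbove (Fin.strictMono_succAbove i) (u k c a q fun j => lam (i.succAbove j)) := by
  rw [incl_u, u, Fin.sum_univ_succAbove _ i]

theorem incl_mul_u (hq : q ≠ 0) (lam : Fin (c + 1) → k) (i : Fin (c + 1)) (b : QCI k c a q) :
    ∃ b₁ b₂ : QCI k c a q,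
      incl i.succAbove (Fin.strictMono_succAbove i) b * u k (c + 1) a q lam =
        u k (c + 1) a q lam * incl i.succAbove (Fin.strictMono_succAbove i) b₁ +
          incl i.succAbove (Fin.strictMono_succAbove i) b₂ := by
  induction b using induction_on with
  | algebraMap r =>
    exact ⟨algebraMap k _ r, 0, by
      rw [AlgHom.commutes, map_zero, add_zero, Algebra.commutes]⟩
  | x l =>
    obtain ⟨r, hr⟩ : ∃ r : k, x k (c + 1) a q (i.succAbove l) * x k (c + 1) a q i =
        r • (x k (c + 1) a q i * x k (c + 1) a q (i.succAbove l)) := by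
      rcases lt_or_gt_of_ne (Fin.succAbove_ne i l) with h | h
      · exact ⟨q, x_mul_x h⟩
      · exact ⟨q⁻¹, by rw [x_mul_x h, smul_smul, inv_mul_cancel₀ hq, one_smul]⟩
    set v := u k c a q fun j => lam (i.succAbove j)
    refine ⟨r • x k c a q l, x k c a q l * v - r • (v * x k c a q l), ?_⟩
    rw [u_eq_succAbove lam i, map_sub, map_smul, map_smul, map_mul, map_mul, incl_x, mul_add,
      mul_smul_comm, hr, add_mul, smul_mul_assoc, mul_smul_comm, mul_smul_comm]
    abel
  | add b b' h h' =>
    obtain ⟨b₁, b₂, h⟩ := h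
    obtain ⟨b₁', b₂', h'⟩ := h'
    refine ⟨b₁ + b₁', b₂ + b₂', ?_⟩
    rw [map_add, add_mul, h, h', map_add, map_add, mul_add]
    abel
  | mul b b' h h' =>
    obtain ⟨b₁', b₂', h'⟩ := h'
    obtain ⟨b₁, b₂, h⟩ := h
    refine ⟨b₁ * b₁', b₂ * b₁' + b * b₂', ?_⟩
    rw [map_mul, mul_assoc, h', mul_add, ← mul_assoc, h, map_mul, map_add, map_mul, map_mul]
    noncomm_ring

theorem expand_surjective (ha : a ≠ 0) (hq : IsPrimitiveRoot q (aprime k a))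
    (lam : Fin (c + 1) → k) {i : Fin (c + 1)} (hi : lam i ≠ 0) :
    Function.Surjective (expand (a := a) (q := q) lam i) := by
  set S := LinearMap.range (expand (a := a) (q := q) lam i)
  set U := u k (c + 1) a q lam with hU
  set ι := incl (k := k) (a := a) (q := q) i.succAbove (Fin.strictMono_succAbove i) with hι
  have hmem : ∀ (j : ℕ) (b : QCI k c a q), U ^ j * ι b ∈ S := by
    intro j b
    rcases lt_or_ge j a with hj | hj
    · exact ⟨Pi.single ⟨j, hj⟩ b, expand_single lam i ⟨j, hj⟩ b⟩
    · rw [hU, pow_eq_zero_of_le hj (u_pow ha hq lam), zero_mul]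
      exact zero_mem _
  have hle : ∀ z, (∀ j b, z * (U ^ j * ι b) ∈ S) → ∀ s ∈ S, z * s ∈ S := by
    rintro z hz _ ⟨f, rfl⟩
    rw [expand_apply, Finset.mul_sum]
    exact Submodule.sum_mem _ fun j _ => hz _ _
  have hUS : ∀ s ∈ S, U * s ∈ S := hle U fun j b => by
    rw [← mul_assoc, ← pow_succ']; exact hmem _ _
  have hιS : ∀ b, ∀ s ∈ S, ι b * s ∈ S := by
    intro b
    refine hle _ fun j w => ?_
    induction j generalizing b with
    | zero => simpa using hmem 0 (b * w)
    | succ j ih =>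
      obtain ⟨b₁, b₂, h⟩ := incl_mul_u (hq.ne_zero (aprime_ne_zero ha)) lam i b
      rw [pow_succ', mul_assoc, ← mul_assoc, h, add_mul, mul_assoc]
      exact add_mem (hUS _ (ih _)) (ih _)
  have hS : ∀ b : QCI k (c + 1) a q, ∀ s ∈ S, b * s ∈ S := by
    intro b
    induction b using induction_on with
    | algebraMap r => intro s hs; rw [← Algebra.smul_def]; exact S.smul_mem r hs
    | x l =>
      intro s hs
      rcases Fin.eq_self_or_eq_succAbove i l with rfl | ⟨l, rfl⟩
      · have h : x k (c + 1) a q l = (lam l)⁻¹ •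
            (U - ι (u k c a q fun j => lam (l.succAbove j))) := by
          rw [hU, u_eq_succAbove lam l, add_sub_cancel_right, smul_smul, inv_mul_cancel₀ hi,
            one_smul]
        rw [h, smul_mul_assoc, sub_mul]
        exact S.smul_mem _ (sub_mem (hUS s hs) (hιS _ s hs))
      · have := hιS (x k c a q l) s hs
        rwa [hι, incl_x] at this
    | add b b' h h' => intro s hs; rw [add_mul]; exact add_mem (h s hs) (h' s hs)
    | mul b b' h h' => intro s hs; rw [mul_assoc]; exact h _ (h' s hs)
  intro b
  have := hS b 1 (by simpa using hmem 0 1)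
  rwa [mul_one] at this

theorem algebraMap_surjective_zero : Function.Surjective (algebraMap k (QCI k 0 a q)) := by
  intro b
  induction b using induction_on with
  | algebraMap r => exact ⟨r, rfl⟩
  | x i => exact i.elim0
  | add b b' h h' =>
    obtain ⟨r, rfl⟩ := h
    obtain ⟨r', rfl⟩ := h'
    exact ⟨r + r', map_add _ _ _⟩
  | mul b b' h h' =>
    obtain ⟨r, rfl⟩ := h
    obtain ⟨r', rfl⟩ := h'
    exact ⟨r * r', map_mul _ _ _⟩

theorem finite (ha : a ≠ 0) (hq : IsPrimitiveRoot q (aprime k a)) :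
    Module.Finite k (QCI k c a q) := by
  induction c with
  | zero => exact Module.Finite.of_surjective (Algebra.linearMap k _) algebraMap_surjective_zero
  | succ c ih =>
    exact Module.Finite.of_surjective _
      (expand_surjective ha hq (fun _ => (1 : k)) (i := 0) one_ne_zero)

/-- The shift operator on `Fin a → V`. -/
def shift (k : Type) [Field k] (a : ℕ) (V : Type*) [AddCommGroup V] [Module k V] :
    Module.End k (Fin a → V) where
  toFun g j := if h : (j : ℕ) = 0 then 0 else g ⟨j - 1, by omega⟩
  map_add' g g' := by
    funext j
    by_cases h : (j : ℕ) = 0 <;> simp [h]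
  map_smul' r g := by
    funext j
    by_cases h : (j : ℕ) = 0 <;> simp [h]

theorem shift_pow_apply {V : Type*} [AddCommGroup V] [Module k V] (n : ℕ) (g : Fin a → V)
    (j : Fin a) : (shift k a V ^ n) g j = if (j : ℕ) < n then 0 else g ⟨j - n, by omega⟩ := by
  induction n generalizing j with
  | zero => simp
  | succ n ih =>
    rw [pow_succ', Module.End.mul_apply]
    change (if h : (j : ℕ) = 0 then 0 else (shift k a V ^ n) g ⟨j - 1, _⟩) = _
    split_ifs with h h' h'
    · rfl
    · omega
    · rw [ih, if_pos (by simp; omega)]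
    · rw [ih, if_neg (by simp; omega)]
      congr 2
      simp
      omega

/-- The twisted diagonal multiplication by `x_i` on `Fin a → QCI k c a q`. -/
noncomputable def twistedMul (k : Type) [Field k] (c a : ℕ) (q : k) (i : Fin c) :
    Module.End k (Fin a → QCI k c a q) :=
  LinearMap.pi fun j => q ^ (j : ℕ) • LinearMap.mulLeft k (x k c a q i) ∘ₗ LinearMap.proj j

theorem twistedMul_apply (i : Fin c) (g : Fin a → QCI k c a q) (j : Fin a) :
    twistedMul k c a q i g j = q ^ (j : ℕ) • (x k c a q i * g j) := rfl

theorem twistedMul_pow_apply (i : Fin c) (n : ℕ) (g : Fin a → QCI k c a q) (j : Fin a) :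
    (twistedMul k c a q i ^ n) g j = (q ^ (j : ℕ)) ^ n • (x k c a q i ^ n * g j) := by
  induction n with
  | zero => simp
  | succ n ih =>
    rw [pow_succ', Module.End.mul_apply, twistedMul_apply, ih, mul_smul_comm, smul_smul,
      ← mul_assoc, ← pow_succ', ← pow_succ']

/-- The action of the algebra in `c + 1` variables on `a` copies of the algebra in `c` variables. -/
noncomputable def toEnd (k : Type) [Field k] (c a : ℕ) (q : k) :
    QCI k (c + 1) a q →ₐ[k] Module.End k (Fin a → QCI k c a q) :=
  lift (Fin.lastCases (shift k a _) (twistedMul k c a q))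
    (by
      intro i
      refine LinearMap.ext fun g => funext fun j => ?_
      refine Fin.lastCases ?_ (fun i => ?_) i
      · rw [Fin.lastCases_last, shift_pow_apply, if_pos j.2]; rfl
      · rw [Fin.lastCases_castSucc, twistedMul_pow_apply, x_pow, zero_mul, smul_zero]; rfl)
    (by
      intro i j
      refine Fin.lastCases (fun h => absurd h (Fin.le_last j).not_gt) (fun i => ?_) i
      refine Fin.lastCases (fun _ => ?_) (fun j hij => ?_) j
      · rw [Fin.lastCases_last, Fin.lastCases_castSucc]
        refine LinearMap.ext fun g => funext fun l => ?_
        rw [Module.End.mul_apply, twistedMul_apply, LinearMap.smul_apply, Module.End.mul_apply,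
          Pi.smul_apply]
        change q ^ (l : ℕ) • (x k c a q i * (if h : (l : ℕ) = 0 then 0 else _)) =
          q • (if h : (l : ℕ) = 0 then 0 else _)
        split_ifs with h
        · simp
        · rw [twistedMul_apply, smul_smul, ← pow_succ']
          simp only [Nat.sub_add_cancel (Nat.one_le_iff_ne_zero.2 h)]
      · rw [Fin.lastCases_castSucc, Fin.lastCases_castSucc]
        refine LinearMap.ext fun g => funext fun l => ?_
        rw [Module.End.mul_apply, twistedMul_apply, twistedMul_apply, LinearMap.smul_apply,
          Module.End.mul_apply, Pi.smul_apply, twistedMul_apply, twistedMul_apply, mul_smul_comm,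
          mul_smul_comm, ← mul_assoc, ← mul_assoc, x_mul_x (Fin.castSucc_lt_castSucc_iff.1 hij),
          smul_mul_assoc, smul_comm q, smul_comm q])

theorem toEnd_x_last : toEnd k c a q (x k (c + 1) a q (Fin.last c)) = shift k a _ := by
  rw [toEnd, lift_x, Fin.lastCases_last]

theorem toEnd_x_castSucc (i : Fin c) :
    toEnd k c a q (x k (c + 1) a q i.castSucc) = twistedMul k c a q i := by
  rw [toEnd, lift_x, Fin.lastCases_castSucc]

theorem toEnd_incl_single (ha : 0 < a) (b w : QCI k c a q) :
    toEnd k c a q (incl Fin.castSucc Fin.strictMono_castSucc b) (Pi.single ⟨0, ha⟩ w) =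
      Pi.single ⟨0, ha⟩ (b * w) := by
  induction b using induction_on generalizing w with
  | algebraMap r =>
    rw [AlgHom.commutes, AlgHom.commutes, Module.algebraMap_end_apply, ← Algebra.smul_def,
      Pi.single_smul]
  | x i =>
    rw [incl_x, toEnd_x_castSucc]
    funext j
    rw [twistedMul_apply]
    by_cases h : j = ⟨0, ha⟩
    · subst h; simp
    · simp [Pi.single_eq_of_ne h]
  | add b b' h h' => rw [map_add, map_add, LinearMap.add_apply, h, h', add_mul, Pi.single_add]
  | mul b b' h h' => rw [map_mul, map_mul, Module.End.mul_apply, h', h, mul_assoc]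

theorem shift_pow_single {V : Type*} [AddCommGroup V] [Module k V] (ha : 0 < a) (j : Fin a)
    (w : V) : (shift k a V ^ (j : ℕ)) (Pi.single ⟨0, ha⟩ w) = Pi.single j w := by
  funext l
  rw [shift_pow_apply]
  split_ifs with h
  · rw [Pi.single_eq_of_ne (by rintro rfl; omega)]
  · by_cases hl : l = j
    · subst hl; simp
    · rw [Pi.single_eq_of_ne hl, Pi.single_eq_of_ne]
      intro h'
      have := congrArg Fin.val h'
      simp only at this
      exact hl (Fin.ext (by omega))

theorem toEnd_apply_surjective (ha : 0 < a) :
    Function.Surjective fun b : QCI k (c + 1) a q => toEnd k c a q b (Pi.single ⟨0, ha⟩ 1) := by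
  intro f
  refine ⟨∑ j : Fin a, x k (c + 1) a q (Fin.last c) ^ (j : ℕ) *
    incl Fin.castSucc Fin.strictMono_castSucc (f j), ?_⟩
  simp only [map_sum, LinearMap.sum_apply, map_mul, map_pow, Module.End.mul_apply,
    toEnd_incl_single, toEnd_x_last, shift_pow_single, mul_one]
  exact Finset.univ_sum_single f

theorem finrank_succ (ha : a ≠ 0) (hq : IsPrimitiveRoot q (aprime k a)) :
    Module.finrank k (QCI k (c + 1) a q) = Module.finrank k (Fin a → QCI k c a q) := by
  have := finite (c := c) ha hq
  have := finite (c := c + 1) ha hq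
  refine le_antisymm ?_ ?_
  · exact LinearMap.finrank_le_finrank_of_surjective
      (expand_surjective ha hq (fun _ => (1 : k)) (i := 0) one_ne_zero)
  · exact LinearMap.finrank_le_finrank_of_surjective
      (f := (LinearMap.applyₗ (Pi.single ⟨0, Nat.pos_of_ne_zero ha⟩ 1)) ∘ₗ
        (toEnd k c a q).toLinearMap) (toEnd_apply_surjective _)

theorem expand_injective (ha : a ≠ 0) (hq : IsPrimitiveRoot q (aprime k a))
    (lam : Fin (c + 1) → k) {i : Fin (c + 1)} (hi : lam i ≠ 0) :
    Function.Injective (expand (a := a) (q := q) lam i) := by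
  have := finite (c := c) ha hq
  have := finite (c := c + 1) ha hq
  exact (LinearMap.injective_iff_surjective_of_finrank_eq_finrank (finrank_succ ha hq).symm).2
    (expand_surjective ha hq lam hi)

theorem nontrivial (ha : a ≠ 0) : Nontrivial (QCI k c a q) :=
  (lift (B := k) (fun _ : Fin c => 0) (fun _ => zero_pow ha) (by simp)).toRingHom.domain_nontrivial

theorem exists_eq_u_mul (ha : a ≠ 0) (hq : IsPrimitiveRoot q (aprime k a)) {lam : Fin c → k}
    (hlam : lam ≠ 0) (b : QCI k c a q) (hb : u k c a q lam ^ (a - 1) * b = 0) :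
    ∃ d, b = u k c a q lam * d := by
  obtain ⟨i, hi⟩ := Function.ne_iff.1 hlam
  obtain _ | c := c
  · exact i.elim0
  obtain ⟨a, rfl⟩ := Nat.exists_eq_succ_of_ne_zero ha
  obtain ⟨f, rfl⟩ := expand_surjective ha hq lam hi b
  rw [expand_apply, Fin.sum_univ_succ] at hb ⊢
  simp only [Fin.val_zero, pow_zero, one_mul, Fin.val_succ, pow_succ', mul_assoc,
    ← Finset.mul_sum] at hb ⊢
  rw [mul_add, ← mul_assoc _ (u k (c + 1) (a + 1) q lam), ← pow_succ,
    Nat.sub_add_cancel a.succ_pos, u_pow ha hq, zero_mul, add_zero] at hb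
  have h0 := expand_injective ha hq lam hi (a₁ := Pi.single (Fin.last a) (f 0)) (a₂ := 0)
    (by rw [expand_single, map_zero]; exact hb)
  rw [Pi.single_eq_zero_iff] at h0
  rw [h0, map_zero, zero_add]
  exact ⟨_, rfl⟩

/-- The anti-automorphism reversing the order of the variables. -/
noncomputable def reverse (k : Type) [Field k] (c a : ℕ) (q : k) :
    QCI k c a q →ₐ[k] (QCI k c a q)ᵐᵒᵖ :=
  lift (fun i => MulOpposite.op (x k c a q i.rev))
    (fun i => by rw [← MulOpposite.op_pow, x_pow, MulOpposite.op_zero])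
    fun i j hij => by
      rw [← MulOpposite.op_mul, x_mul_x (Fin.rev_lt_rev.2 hij), ← MulOpposite.op_mul,
        ← MulOpposite.op_smul]

theorem reverse_x (i : Fin c) :
    reverse k c a q (x k c a q i) = MulOpposite.op (x k c a q i.rev) :=
  lift_x _ _ _ _

theorem reverse_reverse (b : QCI k c a q) :
    (reverse k c a q (reverse k c a q b).unop).unop = b := by
  induction b using induction_on with
  | algebraMap r => simp
  | x i => simp [reverse_x]
  | add b b' h h' => simp [h, h']
  | mul b b' h h' => simp [h, h']

theorem reverse_u (lam : Fin c → k) :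
    reverse k c a q (u k c a q lam) = MulOpposite.op (u k c a q fun i => lam i.rev) := by
  rw [u, map_sum, u, Finset.op_sum, ← Equiv.sum_comp Fin.revPerm]
  refine Finset.sum_congr rfl fun i _ => ?_
  simp [reverse_x]

theorem reverse_injective : Function.Injective (reverse k c a q) := fun b b' h => by
  rw [← reverse_reverse b, h, reverse_reverse]

theorem exists_eq_mul_of_reverse {lam : Fin c → k} {m n : ℕ}
    (h : ∀ b, u k c a q (fun i => lam i.rev) ^ m * b = 0 →
      ∃ d, b = u k c a q (fun i => lam i.rev) ^ n * d)
    (b : QCI k c a q) (hb : b * u k c a q lam ^ m = 0) : ∃ d, b = d * u k c a q lam ^ n := by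
  obtain ⟨d, hd⟩ := h (reverse k c a q b).unop (by
    apply MulOpposite.op_injective
    rw [MulOpposite.op_mul, MulOpposite.op_unop, MulOpposite.op_pow, ← reverse_u, ← map_pow,
      ← map_mul, hb, map_zero, MulOpposite.op_zero])
  refine ⟨(reverse k c a q d).unop, reverse_injective ?_⟩
  apply MulOpposite.unop_injective
  rw [map_mul, map_pow, reverse_u, MulOpposite.unop_mul, reverse_reverse, hd,
    MulOpposite.unop_pow, MulOpposite.unop_op]

theorem u_pow_pred_ne_zero (ha : a ≠ 0) (hq : IsPrimitiveRoot q (aprime k a)) {lam : Fin c → k}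
    (hlam : lam ≠ 0) : u k c a q lam ^ (a - 1) ≠ 0 := by
  intro h
  obtain ⟨d, hd⟩ := exists_eq_u_mul ha hq hlam 1 (by rw [h, zero_mul])
  have := nontrivial (k := k) (c := c) (q := q) ha
  have hj : ∀ j, u k c a q lam ^ j ≠ 0 := by
    intro j
    induction j with
    | zero => simp
    | succ j ih =>
      intro h
      rw [← mul_one (u k c a q lam ^ j), hd, ← mul_assoc, ← pow_succ, h, zero_mul] at ih
      exact ih rfl
  exact hj _ h

theorem exists_eq_algebraMap_add_u_mul (lam : Fin c → k)
    (r : Algebra.adjoin k {u k c a q lam}) :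
    ∃ (e : k) (s : Algebra.adjoin k {u k c a q lam}), r = algebraMap k _ e +
      ⟨u k c a q lam, Algebra.subset_adjoin (Set.mem_singleton _)⟩ * s := by
  obtain ⟨r, hr⟩ := r
  have hr' := hr
  rw [Algebra.adjoin_singleton_eq_range_aeval] at hr'
  obtain ⟨p, rfl⟩ := hr'
  refine ⟨p.coeff 0, ⟨Polynomial.aeval (u k c a q lam) p.divX, ?_⟩, Subtype.ext ?_⟩
  · rw [Algebra.adjoin_singleton_eq_range_aeval]; exact ⟨_, rfl⟩
  · change Polynomial.aeval _ p = algebraMap k _ _ + u k c a q lam * Polynomial.aeval _ p.divX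
    conv_lhs => rw [← Polynomial.X_mul_divX_add p]
    rw [map_add, map_mul, Polynomial.aeval_X, Polynomial.aeval_C, add_comm]

theorem projective_adjoin_u_iff (ha : a ≠ 0) (hq : IsPrimitiveRoot q (aprime k a))
    {lam : Fin c → k} (hlam : lam ≠ 0) {M : Type} [AddCommGroup M] [Module (QCI k c a q) M] :
    Module.Projective (Algebra.adjoin k {u k c a q lam}) M ↔
      ∀ m : M, u k c a q lam ^ (a - 1) • m = 0 → ∃ n : M, m = u k c a q lam • n := by
  let t : Algebra.adjoin k {u k c a q lam} :=
    ⟨u k c a q lam, Algebra.subset_adjoin (Set.mem_singleton _)⟩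
  have ht : t ^ a = 0 := Subtype.ext (u_pow ha hq lam)
  constructor
  · intro _ m hm
    refine exists_smul_eq_of_projective (s := t) (t := t ^ (a - 1)) (fun b hb => ?_) m hm
    obtain ⟨e, s, rfl⟩ := exists_eq_algebraMap_add_u_mul lam b
    change t ^ (a - 1) * (_ + t * s) = 0 at hb
    rw [mul_add, ← mul_assoc, ← pow_succ, Nat.sub_add_cancel (Nat.one_le_iff_ne_zero.2 ha), ht,
      zero_mul, add_zero, ← Algebra.commutes, ← Algebra.smul_def] at hb
    have he : e = 0 := (smul_eq_zero.1 hb).resolve_right fun h =>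
      u_pow_pred_ne_zero ha hq hlam (congrArg Subtype.val h)
    exact ⟨s, by rw [he, map_zero, zero_add]⟩
  · intro h
    let _ : Module k M := Module.compHom M (algebraMap k (QCI k c a q))
    have : IsScalarTower k (Algebra.adjoin k {u k c a q lam}) M := ⟨fun e r m => by
      change (e • (r : QCI k c a q)) • m = algebraMap k (QCI k c a q) e • (r : QCI k c a q) • m
      rw [Algebra.smul_def, mul_smul]⟩
    have := free_of_ker_pow_pred (M := M) ht (exists_eq_algebraMap_add_u_mul lam) h
    infer_instance

end QCI


/-- For nonzero `λ ∈ k^c` and a finitely generated left `A`-module `M`, the following are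
equivalent: (i) `M` is not projective over the subalgebra `k[u_λ]` of `A` generated by `u_λ`;
(ii) some `A`-module homomorphism `Au_λ → M` does not factor through a projective `A`-module;
(iii) some `A`-module homomorphism `Au_λ^{a-1} → M` does not factor through a projective
`A`-module. -/
theorem not_projective_iff_exists_nonfactoring_hom (k : Type) [Field k] [IsAlgClosed k]
    (a c : ℕ) (ha : 2 ≤ a) (hc : 1 ≤ c) (q : k) (hq : IsPrimitiveRoot q (aprime k a))
    (lam : Fin c → k) (hlam : lam ≠ 0)
    (M : Type) [AddCommGroup M] [Module (QCI k c a q) M] [Module.Finite (QCI k c a q) M] :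
    (¬ Module.Projective (Algebra.adjoin k {QCI.u k c a q lam}) M ↔
      ∃ f : (Submodule.span (QCI k c a q) {QCI.u k c a q lam}) →ₗ[QCI k c a q] M,
        ∀ (P : Type) (_ : AddCommGroup P) (_ : Module (QCI k c a q) P),
          Module.Projective (QCI k c a q) P →
          ∀ (g : (Submodule.span (QCI k c a q) {QCI.u k c a q lam}) →ₗ[QCI k c a q] P)
            (h : P →ₗ[QCI k c a q] M), f ≠ h ∘ₗ g) ∧
    (¬ Module.Projective (Algebra.adjoin k {QCI.u k c a q lam}) M ↔
      ∃ f : (Submodule.span (QCI k c a q) {QCI.u k c a q lam ^ (a - 1)}) →ₗ[QCI k c a q] M,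
        ∀ (P : Type) (_ : AddCommGroup P) (_ : Module (QCI k c a q) P),
          Module.Projective (QCI k c a q) P →
          ∀ (g : (Submodule.span (QCI k c a q)
              {QCI.u k c a q lam ^ (a - 1)}) →ₗ[QCI k c a q] P)
            (h : P →ₗ[QCI k c a q] M), f ≠ h ∘ₗ g) := by
  have ha0 : a ≠ 0 := by omega
  set U := QCI.u k c a q lam
  have hpow : U ^ a = 0 := QCI.u_pow ha0 hq lam
  have hpred : ∀ mu : Fin c → k, mu ≠ 0 → ∀ b : QCI k c a q,
      QCI.u k c a q mu ^ (a - 1) * b = 0 → ∃ d, b = QCI.u k c a q mu ^ 1 * d := fun mu hmu b hb =>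
    by simpa using QCI.exists_eq_u_mul ha0 hq hmu b hb
  have hone : ∀ mu : Fin c → k, mu ≠ 0 → ∀ b : QCI k c a q,
      QCI.u k c a q mu ^ 1 * b = 0 → ∃ d, b = QCI.u k c a q mu ^ (a - 1) * d := fun mu hmu b hb =>
    ker_of_ker_pow_pred (t := QCI.u k c a q mu) ha (QCI.exists_eq_u_mul ha0 hq hmu) b
      (by simpa using hb)
  have hrev : (fun i : Fin c => lam i.rev) ≠ 0 := fun h => hlam <| funext fun i => by
    simpa using congrFun h i.rev
  have hproj := QCI.projective_adjoin_u_iff ha0 hq hlam (M := M)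
  constructor
  · rw [exists_nonfactoring_iff (s := U) (t := U ^ (a - 1))
      (by rw [← pow_succ, Nat.sub_add_cancel (by omega), hpow])
      (QCI.exists_eq_u_mul ha0 hq hlam)
      (fun b hb => QCI.exists_eq_mul_of_reverse (hone _ hrev) b (by simpa using hb)), hproj]
    push Not
    rfl
  · rw [exists_nonfactoring_iff (s := U ^ (a - 1)) (t := U)
      (by rw [← pow_succ', Nat.sub_add_cancel (by omega), hpow])
      (fun b hb => hone lam hlam b (by simpa using hb))
      (fun b hb => by simpa using QCI.exists_eq_mul_of_reverse (hpred _ hrev) b hb), hproj,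
      show (∀ m : M, U ^ (a - 1) • m = 0 → ∃ n : M, m = U • n) ↔
        ∀ m : M, U • m = 0 → ∃ n : M, m = U ^ (a - 1) • n from
        ⟨ker_of_ker_pow_pred ha, ker_pow_pred_of_ker⟩]
    push Not
    rfl
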